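/- Let Γ be a weighted congestion game with aggregate demands d_t and d_tot ≤ α, costs C² with β ≤ c_e'(x) ≤ ζ and |c_e''(x)| ≤ γ on [0, α], β > 0. Let X_e be the random loads under any mixed Nash equilibrium of Γ and x̂_e the unique Wardrop equilibrium loads of the nonatomic game with the same demands. Then for each resource e, ‖X_e - x̂_e‖_{L²} ≤ Θ·√w, where w = max_i w_i and Θ = √(α/4) + √(2ακ(ζ + γα/4)/β), with κ the cardinality of the largest feasible strategy. -/

import Mathlib

open scoped BigOperators Classical

section Defs

variable {E T N : Type*}

noncomputable def expVal [Fintype E] [Fintype N] (σ : N → Finset E → ℝ)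
    (g : (N → Finset E) → ℝ) : ℝ :=
  ∑ a : N → Finset E, (∏ i, σ i (a i)) * g a

noncomputable def loadW [Fintype E] [Fintype N] (w : N → ℝ) (e : E)
    (a : N → Finset E) : ℝ :=
  ∑ i, if e ∈ a i then w i else 0

noncomputable def loadWi [Fintype E] [Fintype N] (w : N → ℝ) (i : N) (e : E)
    (a : N → Finset E) : ℝ :=
  w i + ∑ j, if j ≠ i ∧ e ∈ a j then w j else 0

def IsMixed [Fintype E] (strat : T → Finset (Finset E)) (tm : N → T)
    (σ : N → Finset E → ℝ) : Prop :=
  (∀ i s, 0 ≤ σ i s) ∧ (∀ i s, s ∉ strat (tm i) → σ i s = 0) ∧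
  (∀ i, ∑ s ∈ strat (tm i), σ i s = 1)

def IsMNE [Fintype E] [Fintype N] (strat : T → Finset (Finset E)) (c : E → ℝ → ℝ)
    (w : N → ℝ) (tm : N → T) (σ : N → Finset E → ℝ) : Prop :=
  IsMixed strat tm σ ∧
  ∀ i, ∀ s ∈ strat (tm i), ∀ s' ∈ strat (tm i), 0 < σ i s →
    expVal σ (fun a => ∑ e ∈ s, c e (loadWi w i e a)) ≤
      expVal σ (fun a => ∑ e ∈ s', c e (loadWi w i e a))

def Feasible [Fintype E] [Fintype T] (strat : T → Finset (Finset E)) (d : T → ℝ)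
    (y : T → Finset E → ℝ) (x : E → ℝ) : Prop :=
  (∀ t s, 0 ≤ y t s) ∧ (∀ t s, s ∉ strat t → y t s = 0) ∧
  (∀ t, d t = ∑ s ∈ strat t, y t s) ∧
  (∀ e, x e = ∑ t, ∑ s ∈ strat t, if e ∈ s then y t s else 0)

def IsWE [Fintype E] [Fintype T] (strat : T → Finset (Finset E)) (c : E → ℝ → ℝ)
    (d : T → ℝ) (y : T → Finset E → ℝ) (x : E → ℝ) : Prop :=
  Feasible strat d y x ∧
  ∀ t, ∀ s ∈ strat t, ∀ s' ∈ strat t, 0 < y t s →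
    ∑ e ∈ s, c e (x e) ≤ ∑ e ∈ s', c e (x e)

end Defs

section RealLemmas

theorem abs_image_sub_sub_le_of_hasDerivWithinAt {f f' : ℝ → ℝ} {s : Set ℝ} {m C a b : ℝ}
    (hs : Convex ℝ s) (hf : ∀ z ∈ s, HasDerivWithinAt f (f' z) s z)
    (hC : ∀ z ∈ s, |f' z - m| ≤ C) (ha : a ∈ s) (hb : b ∈ s) :
    |f b - f a - m * (b - a)| ≤ C * |b - a| := by
  have h := hs.norm_image_sub_le_of_norm_hasDerivWithin_le (f := fun z => f z - m * z)
    (f' := fun z => f' z - m) (C := C)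
    (fun z hz => by
      simpa [Pi.sub_def] using (hf z hz).sub ((hasDerivWithinAt_id z s).const_mul m))
    (fun z hz => by simpa using hC z hz) ha hb
  rw [Real.norm_eq_abs, Real.norm_eq_abs] at h
  convert h using 2
  ring

theorem abs_taylor_one_le {f f' f'' : ℝ → ℝ} {s : Set ℝ} {γ a b : ℝ} (hs : Convex ℝ s)
    (hf : ∀ z ∈ s, HasDerivWithinAt f (f' z) s z)
    (hf' : ∀ z ∈ s, HasDerivWithinAt f' (f'' z) s z ∧ |f'' z| ≤ γ)
    (ha : a ∈ s) (hb : b ∈ s) :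
    |f b - f a - f' a * (b - a)| ≤ γ * (b - a) ^ 2 := by
  have hγ : 0 ≤ γ := (abs_nonneg _).trans (hf' a ha).2
  have hsub : Set.uIcc a b ⊆ s := by
    rw [← segment_eq_uIcc]
    exact hs.segment_subset ha hb
  have h := abs_image_sub_sub_le_of_hasDerivWithinAt (f := f) (f' := f') (m := f' a)
    (C := γ * |b - a|) (convex_uIcc a b)
    (fun z hz => (hf z (hsub hz)).mono hsub)
    (fun z hz => by
      have h1 := abs_image_sub_sub_le_of_hasDerivWithinAt (m := 0) hs (fun z hz => (hf' z hz).1)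
        (fun z hz => by simpa using (hf' z hz).2) ha (hsub hz)
      rw [zero_mul, sub_zero] at h1
      exact h1.trans (mul_le_mul_of_nonneg_left (Set.abs_sub_left_of_mem_uIcc hz) hγ))
    Set.left_mem_uIcc Set.right_mem_uIcc
  rwa [mul_assoc, abs_mul_abs_self, ← sq] at h

theorem mul_sub_le_image_sub_and_le {f f' : ℝ → ℝ} {s : Set ℝ} {β ζ a b : ℝ} (hs : Convex ℝ s)
    (hf : ∀ z ∈ s, HasDerivWithinAt f (f' z) s z ∧ β ≤ f' z ∧ f' z ≤ ζ)
    (ha : a ∈ s) (hb : b ∈ s) (hab : a ≤ b) :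
    β * (b - a) ≤ f b - f a ∧ f b - f a ≤ ζ * (b - a) := by
  have h := abs_image_sub_sub_le_of_hasDerivWithinAt (m := (β + ζ) / 2) (C := (ζ - β) / 2) hs
    (fun z hz => (hf z hz).1)
    (fun z hz => abs_le.2 ⟨by linarith [(hf z hz).2.1], by linarith [(hf z hz).2.2]⟩) ha hb
  rw [abs_of_nonneg (sub_nonneg.2 hab)] at h
  obtain ⟨h1, h2⟩ := abs_le.1 h
  constructor <;> linarith

theorem mul_sq_sub_le_image_sub_mul {f f' : ℝ → ℝ} {s : Set ℝ} {β ζ a b : ℝ} (hs : Convex ℝ s)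
    (hf : ∀ z ∈ s, HasDerivWithinAt f (f' z) s z ∧ β ≤ f' z ∧ f' z ≤ ζ)
    (ha : a ∈ s) (hb : b ∈ s) :
    β * (b - a) ^ 2 ≤ (f b - f a) * (b - a) := by
  rcases le_total a b with hab | hab
  · nlinarith [(mul_sub_le_image_sub_and_le hs hf ha hb hab).1]
  · nlinarith [(mul_sub_le_image_sub_and_le hs hf hb ha hab).1]

end RealLemmas

section ExpVal

variable {E N : Type*} [Fintype E] [Fintype N] {σ : N → Finset E → ℝ}

theorem expVal_add (σ : N → Finset E → ℝ) (f g : (N → Finset E) → ℝ) :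
    expVal σ (fun a => f a + g a) = expVal σ f + expVal σ g := by
  simp only [expVal, mul_add, Finset.sum_add_distrib]

theorem expVal_const_mul (σ : N → Finset E → ℝ) (k : ℝ) (f : (N → Finset E) → ℝ) :
    expVal σ (fun a => k * f a) = k * expVal σ f := by
  simp only [expVal, Finset.mul_sum]
  exact Finset.sum_congr rfl fun a _ => by ring

theorem expVal_sum {ι : Type*} (σ : N → Finset E → ℝ) (S : Finset ι)
    (f : ι → (N → Finset E) → ℝ) :
    expVal σ (fun a => ∑ k ∈ S, f k a) = ∑ k ∈ S, expVal σ (f k) := by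
  simp only [expVal, Finset.mul_sum]
  exact Finset.sum_comm

theorem expVal_mono (hσ : ∀ i s, 0 ≤ σ i s) {f g : (N → Finset E) → ℝ} (h : ∀ a, f a ≤ g a) :
    expVal σ f ≤ expVal σ g :=
  Finset.sum_le_sum fun a _ =>
    mul_le_mul_of_nonneg_left (h a) (Finset.prod_nonneg fun i _ => hσ i (a i))

theorem expVal_prod (σ f : N → Finset E → ℝ) :
    expVal σ (fun a => ∏ i, f i (a i)) = ∏ i, ∑ s, σ i s * f i s := by
  simp only [expVal, ← Finset.prod_mul_distrib]
  rw [Finset.prod_univ_sum, Fintype.piFinset_univ]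

theorem expVal_const (h1 : ∀ i, ∑ s, σ i s = 1) (k : ℝ) : expVal σ (fun _ => k) = k := by
  have h := expVal_prod σ (fun _ _ => 1)
  simp only [Finset.prod_const_one, mul_one, h1] at h
  simpa [h] using expVal_const_mul σ k (fun _ => 1)

theorem expVal_eval (h1 : ∀ i, ∑ s, σ i s = 1) (i : N) (f : Finset E → ℝ) :
    expVal σ (fun a => f (a i)) = ∑ s, σ i s * f s := by
  have h := expVal_prod σ (fun j s => if j = i then f s else 1)
  simp only [Finset.prod_ite_eq', Finset.mem_univ, if_true] at h
  rw [h, Finset.prod_eq_single i]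
  · simp
  · intro j _ hj
    simp [hj, h1]
  · simp

theorem expVal_eval_mul_eval_eq_zero {i j : N} (hij : i ≠ j) {f g : Finset E → ℝ}
    (hf : ∑ s, σ i s * f s = 0) : expVal σ (fun a => f (a i) * g (a j)) = 0 := by
  have h := expVal_prod σ (fun k s => (if k = i then f s else 1) * (if k = j then g s else 1))
  simp only [Finset.prod_mul_distrib, Finset.prod_ite_eq', Finset.mem_univ, if_true] at h
  rw [h]
  refine Finset.prod_eq_zero (Finset.mem_univ i) ?_
  simpa [hij] using hf

theorem expVal_sq_sum_eval (h1 : ∀ i, ∑ s, σ i s = 1) {u : N → Finset E → ℝ}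
    (hu : ∀ i, ∑ s, σ i s * u i s = 0) :
    expVal σ (fun a => (∑ i, u i (a i)) ^ 2) = ∑ i, ∑ s, σ i s * u i s ^ 2 := by
  simp only [sq, Finset.sum_mul_sum, expVal_sum]
  refine Finset.sum_congr rfl fun i _ => ?_
  rw [Finset.sum_eq_single i]
  · exact expVal_eval h1 i (fun s => u i s * u i s)
  · intro j _ hj
    exact expVal_eval_mul_eval_eq_zero hj.symm (hu i)
  · simp

theorem expVal_loadW (h1 : ∀ i, ∑ s, σ i s = 1) (w : N → ℝ) (e : E) :
    expVal σ (loadW w e) = ∑ i, ∑ s, σ i s * if e ∈ s then w i else 0 := by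
  unfold loadW
  rw [expVal_sum]
  exact Finset.sum_congr rfl fun i _ => expVal_eval h1 i (fun s => if e ∈ s then w i else 0)

theorem expVal_sq_loadW_sub_mean_le (h1 : ∀ i, ∑ s, σ i s = 1) {w : N → ℝ} (hw : ∀ i, 0 ≤ w i)
    {W : ℝ} (hW : ∀ i, w i ≤ W) (e : E) :
    expVal σ (fun a => (loadW w e a - expVal σ (loadW w e)) ^ 2) ≤ W * (∑ i, w i) / 4 := by
  set f : N → Finset E → ℝ := fun i s => if e ∈ s then w i else 0 with hf
  set m : N → ℝ := fun i => ∑ s, σ i s * f i s with hm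
  have hdev : (fun a => (loadW w e a - expVal σ (loadW w e)) ^ 2) =
      fun a => (∑ i, (f i (a i) - m i)) ^ 2 := by
    funext a
    rw [expVal_loadW h1, Finset.sum_sub_distrib]
    rfl
  rw [hdev, expVal_sq_sum_eval (u := fun i s => f i s - m i) h1, Finset.mul_sum, Finset.sum_div]
  · refine Finset.sum_le_sum fun i _ => ?_
    have hexp : ∑ s, σ i s * (f i s - m i) ^ 2 = w i * m i - m i ^ 2 := by
      have hterm : ∀ s, σ i s * (f i s - m i) ^ 2 =
          (w i - 2 * m i) * (σ i s * f i s) + m i ^ 2 * σ i s := by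
        intro s
        have : f i s ^ 2 = w i * f i s := by
          simp only [hf]
          split_ifs <;> ring
        linear_combination σ i s * this
      simp only [hterm, Finset.sum_add_distrib, ← Finset.mul_sum, h1]
      change (w i - 2 * m i) * m i + _ = _
      ring
    rw [hexp]
    nlinarith [sq_nonneg (w i - 2 * m i), mul_nonneg (hw i) (sub_nonneg.2 (hW i))]
  · intro i
    simp only [mul_sub, Finset.sum_sub_distrib, ← Finset.sum_mul, h1]
    change m i - 1 * m i = 0
    ring

theorem expVal_sq_loadW_sub (h1 : ∀ i, ∑ s, σ i s = 1) (w : N → ℝ) (e : E) (z : ℝ) :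
    expVal σ (fun a => (loadW w e a - z) ^ 2) =
      expVal σ (fun a => (loadW w e a - expVal σ (loadW w e)) ^ 2) +
        (expVal σ (loadW w e) - z) ^ 2 := by
  set x := expVal σ (loadW w e) with hx
  have hsplit : (fun a => (loadW w e a - z) ^ 2) = fun a => (loadW w e a - x) ^ 2 +
      (2 * (x - z) * loadW w e a + ((x - z) ^ 2 - 2 * (x - z) * x)) := by
    funext a
    ring
  rw [hsplit, expVal_add, expVal_add, expVal_const_mul, expVal_const h1, ← hx]
  ring

theorem loadW_mem_Icc {w : N → ℝ} (hw : ∀ i, 0 ≤ w i) {α : ℝ} (hα : ∑ i, w i ≤ α) (e : E)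
    (a : N → Finset E) : loadW w e a ∈ Set.Icc 0 α := by
  constructor
  · exact Finset.sum_nonneg fun i _ => by split_ifs <;> simp [hw]
  · refine le_trans (Finset.sum_le_sum fun i _ => ?_) hα
    split_ifs <;> simp [hw]

theorem loadWi_mem_Icc {w : N → ℝ} (hw : ∀ i, 0 ≤ w i) {α : ℝ} (hα : ∑ i, w i ≤ α) (i : N)
    (e : E) (a : N → Finset E) : loadWi w i e a ∈ Set.Icc 0 α := by
  constructor
  · exact add_nonneg (hw i) (Finset.sum_nonneg fun j _ => by split_ifs <;> simp [hw])
  · refine le_trans ?_ hα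
    have h : w i = ∑ j, if j = i then w j else 0 := by simp
    rw [loadWi, h, ← Finset.sum_add_distrib]
    refine Finset.sum_le_sum fun j _ => ?_
    by_cases hji : j = i <;> by_cases he : e ∈ a j <;> simp [hji, he, hw]

theorem loadWi_eq_loadW_add (w : N → ℝ) (i : N) (e : E) (a : N → Finset E) :
    loadWi w i e a = loadW w e a + if e ∈ a i then 0 else w i := by
  have h : (if e ∈ a i then w i else 0) = ∑ j, if j = i then (if e ∈ a j then w j else 0) else 0 := by
    simp
  have h2 : loadW w e a = (∑ j, if j ≠ i ∧ e ∈ a j then w j else 0) +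
      if e ∈ a i then w i else 0 := by
    rw [h, ← Finset.sum_add_distrib]
    refine Finset.sum_congr rfl fun j _ => ?_
    by_cases hji : j = i <;> by_cases he : e ∈ a j <;> simp [hji]
  rw [loadWi, h2]
  split_ifs <;> ring

theorem abs_expVal_cost_sub_le (hσ : ∀ i s, 0 ≤ σ i s) (h1 : ∀ i, ∑ s, σ i s = 1)
    {f f' f'' : ℝ → ℝ} {α γ : ℝ}
    (hf : ∀ z ∈ Set.Icc (0 : ℝ) α, HasDerivWithinAt f (f' z) (Set.Icc 0 α) z)
    (hf' : ∀ z ∈ Set.Icc (0 : ℝ) α, HasDerivWithinAt f' (f'' z) (Set.Icc 0 α) z ∧ |f'' z| ≤ γ)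
    {w : N → ℝ} (hw : ∀ i, 0 ≤ w i) (hα : ∑ i, w i ≤ α) {W : ℝ} (hW : ∀ i, w i ≤ W)
    (hW0 : 0 ≤ W) (e : E) :
    |expVal σ (fun a => f (loadW w e a)) - f (expVal σ (loadW w e))| ≤ γ * (W * α / 4) := by
  set x := expVal σ (loadW w e) with hx
  have hxm : x ∈ Set.Icc 0 α := by
    constructor
    · simpa [expVal_const h1] using
        expVal_mono hσ (f := fun _ => 0) (fun a => (loadW_mem_Icc hw hα e a).1)
    · simpa [expVal_const h1] using
        expVal_mono hσ (g := fun _ => α) (fun a => (loadW_mem_Icc hw hα e a).2)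
  have hγ : 0 ≤ γ := (abs_nonneg _).trans (hf' x hxm).2
  have hvar : expVal σ (fun a => (loadW w e a - x) ^ 2) ≤ W * α / 4 :=
    (expVal_sq_loadW_sub_mean_le h1 hw hW e).trans (by gcongr)
  have htaylor := fun a =>
    abs_le.1 (abs_taylor_one_le (convex_Icc 0 α) hf hf' hxm (loadW_mem_Icc hw hα e a))
  have hlin : ∀ k : ℝ, expVal σ (fun a => k * (loadW w e a - x) ^ 2 +
      (f' x * loadW w e a + (f x - f' x * x))) =
        k * expVal σ (fun a => (loadW w e a - x) ^ 2) + f x := by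
    intro k
    rw [expVal_add, expVal_add, expVal_const_mul, expVal_const_mul, expVal_const h1, ← hx]
    ring
  have hup := expVal_mono hσ (f := fun a => f (loadW w e a))
    (g := fun a => γ * (loadW w e a - x) ^ 2 + (f' x * loadW w e a + (f x - f' x * x)))
    (fun a => by linarith [(htaylor a).2])
  have hlo := expVal_mono hσ (g := fun a => f (loadW w e a))
    (f := fun a => (-γ) * (loadW w e a - x) ^ 2 + (f' x * loadW w e a + (f x - f' x * x)))
    (fun a => by linarith [(htaylor a).1])
  rw [hlin] at hup hlo
  have := mul_le_mul_of_nonneg_left hvar hγ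
  exact abs_le.2 ⟨by linarith, by linarith⟩

theorem expVal_cost_loadWi_sub_mem_Icc (hσ : ∀ i s, 0 ≤ σ i s) (h1 : ∀ i, ∑ s, σ i s = 1)
    {f f' : ℝ → ℝ} {α β ζ : ℝ} (hβ : 0 ≤ β)
    (hf : ∀ z ∈ Set.Icc (0 : ℝ) α,
      HasDerivWithinAt f (f' z) (Set.Icc 0 α) z ∧ β ≤ f' z ∧ f' z ≤ ζ)
    {w : N → ℝ} (hw : ∀ i, 0 ≤ w i) (hα : ∑ i, w i ≤ α) (i : N) (e : E) :
    expVal σ (fun a => f (loadWi w i e a)) - expVal σ (fun a => f (loadW w e a)) ∈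
      Set.Icc 0 (ζ * w i) := by
  have hbd : ∀ a, f (loadW w e a) ≤ f (loadWi w i e a) ∧
      f (loadWi w i e a) ≤ f (loadW w e a) + ζ * w i := by
    intro a
    have hX := loadW_mem_Icc hw hα e a
    have hζ : 0 ≤ ζ := hβ.trans ((hf _ hX).2.1.trans (hf _ hX).2.2)
    have hle : loadW w e a ≤ loadWi w i e a ∧ loadWi w i e a - loadW w e a ≤ w i := by
      rw [loadWi_eq_loadW_add]
      split_ifs <;> simp [hw]
    obtain ⟨h2, h3⟩ := mul_sub_le_image_sub_and_le (convex_Icc 0 α) hf hX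
      (loadWi_mem_Icc hw hα i e a) hle.1
    constructor
    · nlinarith [mul_nonneg hβ (sub_nonneg.2 hle.1)]
    · linarith [mul_le_mul_of_nonneg_left hle.2 hζ]
  have hlo := expVal_mono hσ (fun a => (hbd a).1)
  have hup := expVal_mono hσ (fun a => (hbd a).2)
  rw [expVal_add, expVal_const h1] at hup
  exact ⟨by linarith, by linarith⟩

end ExpVal

section Equilibria

variable {E T N : Type*} [Fintype E] {strat : T → Finset (Finset E)}

theorem IsMixed.sum_univ {tm : N → T} {σ : N → Finset E → ℝ} (h : IsMixed strat tm σ) (i : N) :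
    ∑ s, σ i s = 1 := by
  rw [← h.2.2 i]
  exact (Finset.sum_subset (Finset.subset_univ _) fun s _ hs => h.2.1 i s hs).symm

theorem sum_mul_le_sum_mul_add_of_approx_min {ι : Type*} {S : Finset ι} {u v A : ι → ℝ} {d ε : ℝ}
    (hu : ∀ s, 0 ≤ u s) (hv : ∀ s, 0 ≤ v s) (hud : d = ∑ s ∈ S, u s) (hvd : d = ∑ s ∈ S, v s)
    (h : ∀ s ∈ S, ∀ s' ∈ S, 0 < u s → A s ≤ A s' + ε) :
    ∑ s ∈ S, u s * A s ≤ ∑ s ∈ S, v s * A s + d * ε := by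
  rcases S.eq_empty_or_nonempty with rfl | hS
  · simp_all
  obtain ⟨s₀, hs₀, hmin⟩ := S.exists_min_image A hS
  have hupper : ∑ s ∈ S, u s * A s ≤ d * (A s₀ + ε) := by
    rw [hud, Finset.sum_mul]
    refine Finset.sum_le_sum fun s hs => ?_
    rcases (hu s).eq_or_lt with h0 | hpos
    · simp [← h0]
    · exact mul_le_mul_of_nonneg_left (h s hs s₀ hs₀ hpos) hpos.le
  have hlower : d * A s₀ ≤ ∑ s ∈ S, v s * A s := by
    rw [hvd, Finset.sum_mul]
    exact Finset.sum_le_sum fun s hs => mul_le_mul_of_nonneg_left (hmin s hs) (hv s)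
  linarith

theorem Feasible.sum_load_mul [Fintype T] {d : T → ℝ} {y : T → Finset E → ℝ} {x : E → ℝ}
    (h : Feasible strat d y x) (C : E → ℝ) :
    ∑ e, x e * C e = ∑ t, ∑ s ∈ strat t, y t s * ∑ e ∈ s, C e := by
  simp only [h.2.2.2, Finset.sum_mul]
  rw [Finset.sum_comm]
  refine Finset.sum_congr rfl fun t _ => ?_
  rw [Finset.sum_comm]
  refine Finset.sum_congr rfl fun s _ => ?_
  simp only [ite_mul, zero_mul, Finset.mul_sum, Finset.sum_ite_mem, Finset.univ_inter]

theorem Feasible.load_mem_Icc [Fintype T] {d : T → ℝ} {y : T → Finset E → ℝ} {x : E → ℝ}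
    (h : Feasible strat d y x) (e : E) : x e ∈ Set.Icc 0 (∑ t, d t) := by
  rw [h.2.2.2 e]
  constructor
  · exact Finset.sum_nonneg fun t _ => Finset.sum_nonneg fun s _ => by split_ifs <;> simp [h.1]
  · refine Finset.sum_le_sum fun t _ => ?_
    rw [h.2.2.1 t]
    exact Finset.sum_le_sum fun s _ => by split_ifs <;> simp [h.1]

theorem Feasible.sum_load_mul_le [Fintype T] {d : T → ℝ} {y y' : T → Finset E → ℝ} {x x' : E → ℝ}
    (h : Feasible strat d y x) (h' : Feasible strat d y' x') {C : E → ℝ} {ε : ℝ}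
    (hC : ∀ t, ∀ s ∈ strat t, ∀ s' ∈ strat t, 0 < y t s → ∑ e ∈ s, C e ≤ ∑ e ∈ s', C e + ε) :
    ∑ e, x e * C e ≤ ∑ e, x' e * C e + (∑ t, d t) * ε := by
  rw [h.sum_load_mul, h'.sum_load_mul, Finset.sum_mul, ← Finset.sum_add_distrib]
  exact Finset.sum_le_sum fun t _ =>
    sum_mul_le_sum_mul_add_of_approx_min (h.1 t) (h'.1 t) (h.2.2.1 t) (h'.2.2.1 t) (hC t)

theorem IsMixed.feasible_expVal_loadW [Fintype T] [Fintype N] {tm : N → T} {σ : N → Finset E → ℝ}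
    (h : IsMixed strat tm σ) {w : N → ℝ} (hw : ∀ i, 0 ≤ w i) :
    Feasible strat (fun t => ∑ i, if tm i = t then w i else 0)
      (fun t s => ∑ i, if tm i = t then w i * σ i s else 0)
      (fun e => expVal σ (loadW w e)) := by
  refine ⟨fun t s => Finset.sum_nonneg fun i _ => ?_, fun t s hs => Finset.sum_eq_zero fun i _ => ?_,
    fun t => ?_, fun e => ?_⟩
  · split_ifs
    · exact mul_nonneg (hw i) (h.1 i s)
    · rfl
  · split_ifs with hi
    · rw [h.2.1 i s (hi ▸ hs), mul_zero]
    · rfl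
  · dsimp only
    rw [Finset.sum_comm]
    refine Finset.sum_congr rfl fun i _ => ?_
    split_ifs with hi
    · rw [← Finset.mul_sum, ← hi, h.2.2 i, mul_one]
    · simp
  · dsimp only
    rw [expVal_loadW h.sum_univ]
    have hswap : ∀ t, (∑ s ∈ strat t, if e ∈ s then ∑ i, (if tm i = t then w i * σ i s else 0)
        else 0) = ∑ i, if tm i = t then ∑ s, σ i s * (if e ∈ s then w i else 0) else 0 := by
      intro t
      have hinner : ∀ s, (if e ∈ s then ∑ i, (if tm i = t then w i * σ i s else 0) else 0) =
          ∑ i, if tm i = t then σ i s * (if e ∈ s then w i else 0) else 0 := by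
        intro s
        split_ifs
        · simp only [mul_comm]
        · simp
      simp only [hinner]
      rw [Finset.sum_comm]
      refine Finset.sum_congr rfl fun i _ => ?_
      split_ifs with hi
      · refine Finset.sum_subset (Finset.subset_univ _) fun s _ hs => ?_
        rw [h.2.1 i s (hi ▸ hs), zero_mul]
      · simp
    simp only [hswap]
    rw [Finset.sum_comm (s := (Finset.univ : Finset T))]
    exact Finset.sum_congr rfl fun i _ => by rw [Finset.sum_ite_eq, if_pos (Finset.mem_univ _)]

theorem IsMNE.cost_expVal_le [Fintype N] {c c' c'' : E → ℝ → ℝ} {α β ζ γ : ℝ} (hβ : 0 ≤ β)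
    (hderiv1 : ∀ e, ∀ z ∈ Set.Icc (0 : ℝ) α,
      HasDerivWithinAt (c e) (c' e z) (Set.Icc 0 α) z ∧ β ≤ c' e z ∧ c' e z ≤ ζ)
    (hderiv2 : ∀ e, ∀ z ∈ Set.Icc (0 : ℝ) α,
      HasDerivWithinAt (c' e) (c'' e z) (Set.Icc 0 α) z ∧ |c'' e z| ≤ γ)
    {w : N → ℝ} (hw : ∀ i, 0 ≤ w i) {tm : N → T} (hα : ∑ i, w i ≤ α)
    {σ : N → Finset E → ℝ} (hNE : IsMNE strat c w tm σ) {W κ : ℝ} (hW : ∀ i, w i ≤ W)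
    (hκ : ∀ t, ∀ s ∈ strat t, (s.card : ℝ) ≤ κ) (hζ : 0 ≤ ζ) (hγ : 0 ≤ γ)
    {i : N} {s s' : Finset E} (hs : s ∈ strat (tm i)) (hs' : s' ∈ strat (tm i))
    (hpos : 0 < σ i s) :
    ∑ e ∈ s, c e (expVal σ (loadW w e)) ≤ ∑ e ∈ s', c e (expVal σ (loadW w e)) +
      2 * κ * W * (ζ + γ * α / 4) := by
  have hW0 : 0 ≤ W := (hw i).trans (hW i)
  have hα0 : 0 ≤ α := (Finset.sum_nonneg fun i _ => hw i).trans hα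
  have hmean := fun e => abs_le.1 (abs_expVal_cost_sub_le hNE.1.1 hNE.1.sum_univ
    (fun z hz => (hderiv1 e z hz).1) (hderiv2 e) hw hα hW hW0 e)
  have hdev := fun e => expVal_cost_loadWi_sub_mem_Icc hNE.1.1 hNE.1.sum_univ hβ (hderiv1 e) hw hα i e
  have hζW := mul_le_mul_of_nonneg_left (hW i) hζ
  have hδ : 0 ≤ γ * (W * α / 4) := by positivity
  have heq := hNE.2 i s hs s' hs' hpos
  rw [expVal_sum, expVal_sum] at heq
  have hlo : ∑ e ∈ s, c e (expVal σ (loadW w e)) ≤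
      ∑ e ∈ s, (expVal σ (fun a => c e (loadWi w i e a)) + γ * (W * α / 4)) :=
    Finset.sum_le_sum fun e _ => by linarith [(hmean e).1, (hdev e).1]
  have hup : ∑ e ∈ s', expVal σ (fun a => c e (loadWi w i e a)) ≤
      ∑ e ∈ s', (c e (expVal σ (loadW w e)) + (ζ * W + γ * (W * α / 4))) :=
    Finset.sum_le_sum fun e _ => by linarith [(hmean e).2, (hdev e).2]
  rw [Finset.sum_add_distrib, Finset.sum_const, nsmul_eq_mul] at hlo hup
  have hb := mul_le_mul_of_nonneg_right (hκ _ s hs) hδ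
  have hb' := mul_le_mul_of_nonneg_right (hκ _ s' hs') (add_nonneg (mul_nonneg hζ hW0) hδ)
  have hκ0 : 0 ≤ κ := (Nat.cast_nonneg _).trans (hκ _ s hs)
  have hslack : 0 ≤ κ * (ζ * W) := by positivity
  linarith

end Equilibria

/-- Non-asymptotic estimate: in a weighted congestion game with total demand at most `α` and
costs with `β ≤ c' ≤ ζ` and `|c''| ≤ γ` on `[0, α]`, for any mixed Nash equilibrium the random
load on each resource is within `Θ √w` (in `L²`) of the unique Wardrop equilibrium load of the
nonatomic game with the same aggregate demands, where `w` is the maximal weight,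
`Θ = √(α/4) + √(2 α κ (ζ + γ α / 4) / β)`, and `κ` is the cardinality of the largest feasible
strategy. -/
theorem stmt13 {E T N : Type*} [Fintype E] [Fintype T] [Fintype N] [Nonempty N]
    (strat : T → Finset (Finset E))
    (hne : (Finset.univ.biUnion strat : Finset (Finset E)).Nonempty)
    (c c' c'' : E → ℝ → ℝ) (α β ζ γ : ℝ) (hβ : 0 < β)
    (hderiv1 : ∀ e, ∀ z ∈ Set.Icc (0 : ℝ) α,
      HasDerivWithinAt (c e) (c' e z) (Set.Icc 0 α) z ∧ β ≤ c' e z ∧ c' e z ≤ ζ)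
    (hderiv2 : ∀ e, ∀ z ∈ Set.Icc (0 : ℝ) α,
      HasDerivWithinAt (c' e) (c'' e z) (Set.Icc 0 α) z ∧ |c'' e z| ≤ γ)
    (w : N → ℝ) (hw : ∀ i, 0 ≤ w i) (tm : N → T)
    (hdtot : ∑ i, w i ≤ α)
    (σ : N → Finset E → ℝ) (hNE : IsMNE strat c w tm σ)
    (yhat : T → Finset E → ℝ) (xhat : E → ℝ)
    (hWE : IsWE strat c (fun t => ∑ i, if tm i = t then w i else 0) yhat xhat)
    (e : E) :
    Real.sqrt (expVal σ (fun a => (loadW w e a - xhat e) ^ 2)) ≤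
      (Real.sqrt (α / 4) +
        Real.sqrt (2 * α * ((Finset.univ.biUnion strat).sup' hne fun s => (s.card : ℝ)) *
          (ζ + γ * α / 4) / β)) *
        Real.sqrt (Finset.univ.sup' Finset.univ_nonempty w) := by
  set W := Finset.univ.sup' Finset.univ_nonempty w with hWdef
  set κ := (Finset.univ.biUnion strat).sup' hne fun s => (s.card : ℝ) with hκdef
  set x : E → ℝ := fun e => expVal σ (loadW w e) with hxdef
  have hW : ∀ i, w i ≤ W := fun i => Finset.le_sup' w (Finset.mem_univ i)
  have hκ : ∀ t, ∀ s ∈ strat t, (s.card : ℝ) ≤ κ := fun t s hs =>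
    Finset.le_sup' (fun s : Finset E => (s.card : ℝ))
      (Finset.mem_biUnion.2 ⟨t, Finset.mem_univ t, hs⟩)
  have hW0 : 0 ≤ W := (hw (Classical.arbitrary N)).trans (hW _)
  have hκ0 : 0 ≤ κ := by
    obtain ⟨s, hs⟩ := hne
    obtain ⟨t, -, hs⟩ := Finset.mem_biUnion.1 hs
    exact (Nat.cast_nonneg _).trans (hκ t s hs)
  have hα0 : 0 ≤ α := (Finset.sum_nonneg fun i _ => hw i).trans hdtot
  have h0 : (0 : ℝ) ∈ Set.Icc 0 α := ⟨le_rfl, hα0⟩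
  have hζ : 0 ≤ ζ := hβ.le.trans ((hderiv1 e 0 h0).2.1.trans (hderiv1 e 0 h0).2.2)
  have hγ : 0 ≤ γ := (abs_nonneg _).trans (hderiv2 e 0 h0).2
  have hd : ∑ t, (∑ i, if tm i = t then w i else 0) = ∑ i, w i := by
    rw [Finset.sum_comm]
    simp
  have hfeas := hNE.1.feasible_expVal_loadW hw
  have hmem : ∀ {y z}, Feasible strat (fun t => ∑ i, if tm i = t then w i else 0) y z →
      ∀ e, z e ∈ Set.Icc 0 α := fun h e =>
    ⟨(h.load_mem_Icc e).1, (h.load_mem_Icc e).2.trans (hd.le.trans hdtot)⟩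
  have hwardrop := hWE.1.sum_load_mul_le (ε := 0) hfeas (C := fun e => c e (xhat e))
    (fun t s hs s' hs' hpos => by simpa using hWE.2 t s hs s' hs' hpos)
  have hnash := hfeas.sum_load_mul_le hWE.1 (C := fun e => c e (x e))
    (ε := 2 * κ * W * (ζ + γ * α / 4)) (fun t s hs s' hs' hpos => by
      obtain ⟨i, -, hi⟩ := Finset.exists_ne_zero_of_sum_ne_zero hpos.ne'
      split_ifs at hi with hti
      · subst hti
        exact hNE.cost_expVal_le hβ.le hderiv1 hderiv2 hw hdtot hW hκ hζ hγ hs hs'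
          ((hNE.1.1 i s).lt_of_ne' (right_ne_zero_of_mul hi))
      · exact absurd rfl hi)
  rw [hd] at hnash
  have hmono : ∑ e, β * (x e - xhat e) ^ 2 ≤
      ∑ e, (c e (x e) - c e (xhat e)) * (x e - xhat e) :=
    Finset.sum_le_sum fun e _ => mul_sq_sub_le_image_sub_mul (convex_Icc 0 α) (hderiv1 e)
      (hmem hWE.1 e) (hmem hfeas e)
  have hexpand : ∑ e, (c e (x e) - c e (xhat e)) * (x e - xhat e) =
      (∑ e, x e * c e (x e) - ∑ e, xhat e * c e (x e)) +
        (∑ e, xhat e * c e (xhat e) - ∑ e, x e * c e (xhat e)) := by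
    simp only [← Finset.sum_sub_distrib, ← Finset.sum_add_distrib]
    exact Finset.sum_congr rfl fun e _ => by ring
  have hsingle : β * (x e - xhat e) ^ 2 ≤ ∑ e, β * (x e - xhat e) ^ 2 :=
    Finset.single_le_sum (f := fun e => β * (x e - xhat e) ^ 2)
      (fun e _ => by positivity) (Finset.mem_univ e)
  have hdtot' : (∑ i, w i) * (2 * κ * W * (ζ + γ * α / 4)) ≤
      α * (2 * κ * W * (ζ + γ * α / 4)) := by gcongr
  have hbias : (x e - xhat e) ^ 2 ≤ 2 * α * κ * (ζ + γ * α / 4) / β * W := by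
    rw [div_mul_eq_mul_div, le_div_iff₀ hβ]
    linarith
  have hvar : expVal σ (fun a => (loadW w e a - x e) ^ 2) ≤ α / 4 * W :=
    (expVal_sq_loadW_sub_mean_le hNE.1.sum_univ hw hW e).trans
      (by linarith [mul_le_mul_of_nonneg_left hdtot hW0])
  rw [expVal_sq_loadW_sub hNE.1.sum_univ]
  refine Real.sqrt_le_iff.2 ⟨by positivity, ?_⟩
  have hA : 0 ≤ α / 4 := by positivity
  have hB : 0 ≤ 2 * α * κ * (ζ + γ * α / 4) / β := by positivity
  rw [mul_pow, Real.sq_sqrt hW0, add_sq, Real.sq_sqrt hA, Real.sq_sqrt hB]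
  have hcross : 0 ≤ 2 * √(α / 4) * √(2 * α * κ * (ζ + γ * α / 4) / β) * W := by positivity
  linarith
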